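/- arXiv:1903.11679 — 4 statements merged into one kernel-verified Lean document; each statement's English description precedes it below -/
import Mathlib

section
/- Over the field $\mathbb{Q}$ of rational numbers, the diagonal quadratic forms $\langle -2, -6, -3 \rangle$ and $\langle -1, -1, -1 \rangle$ are equivalent, i.e., there is a linear isometry equivalence between the quadratic form $-2x^2 - 6y^2 - 3z^2$ and the quadratic form $-x^2 - y^2 - z^2$ on $\mathbb{Q}^3$. -/
/-- The linear automorphism of `ℚ³` sending the standard basis to the orthogonal vectors
`(1, 1, 0)`, `(1, -1, 2)`, `(1, -1, -1)`, of squared lengths `2`, `6`, `3`. -/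
def orthogonalFrameEquiv : (Fin 3 → ℚ) ≃ₗ[ℚ] (Fin 3 → ℚ) where
  toFun v := ![v 0 + v 1 + v 2, v 0 - v 1 - v 2, 2 * v 1 - v 2]
  invFun w := ![(w 0 + w 1) / 2, (w 0 - w 1 + 2 * w 2) / 6, (w 0 - w 1 - w 2) / 3]
  map_add' v w := by
    ext i
    fin_cases i <;> simp <;> ring
  map_smul' c v := by
    ext i
    fin_cases i <;> simp <;> ring
  left_inv v := by
    ext i
    fin_cases i <;> simp <;> ring
  right_inv w := by
    ext i
    fin_cases i <;> simp <;> ring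

theorem diag_form_neg2_neg6_neg3_equiv_neg1_neg1_neg1_rat :
    QuadraticMap.Equivalent
      (QuadraticMap.weightedSumSquares ℚ ![(-2 : ℚ), -6, -3])
      (QuadraticMap.weightedSumSquares ℚ ![(-1 : ℚ), -1, -1]) := by
  refine ⟨⟨orthogonalFrameEquiv, fun v => ?_⟩⟩
  simp [orthogonalFrameEquiv, QuadraticMap.weightedSumSquares_apply, Fin.sum_univ_three]
  ring
end

section
/- Let $R$ be a commutative ring and let $u, u_1, u_2 \in R$ with $u_1^2 = 0$ and $u_2^2 = 0$. Set $e_1 = 0$, $e_2 = -2u^2$, $e_3 = -8u_1u_2u$, $e_4 = u^4$, and define the Newton power-sum sequence $p : \mathbb{N}_{\ge 1} \to R$ by $p_1 = e_1$, $p_2 = e_1p_1 - 2e_2$, $p_3 = e_1p_2 - e_2p_1 + 3e_3$, $p_4 = e_1p_3 - e_2p_2 + e_3p_1 - 4e_4$, and $p_m = e_1p_{m-1} - e_2p_{m-2} + e_3p_{m-3} - e_4p_{m-4}$ for $m \ge 5$. Then $p_1 = 0$, for every even $m \ge 2$ one has $p_m = 4u^m$, and for every odd $m \ge 3$ one has $p_m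 = -4m(m-1)\,u_1u_2u^{m-2}$. -/
theorem witt_newton_power_sums (R : Type*) [CommRing R]
    (u u₁ u₂ : R) (hu₁ : u₁ ^ 2 = 0) (hu₂ : u₂ ^ 2 = 0)
    (e₁ e₂ e₃ e₄ : R)
    (he₁ : e₁ = 0) (he₂ : e₂ = -2 * u ^ 2) (he₃ : e₃ = -8 * (u₁ * u₂ * u))
    (he₄ : e₄ = u ^ 4)
    (p : ℕ → R)
    (hp1 : p 1 = e₁)
    (hp2 : p 2 = e₁ * p 1 - 2 * e₂)
    (hp3 : p 3 = e₁ * p 2 - e₂ * p 1 + 3 * e₃)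
    (hp4 : p 4 = e₁ * p 3 - e₂ * p 2 + e₃ * p 1 - 4 * e₄)
    (hp : ∀ m : ℕ, 5 ≤ m →
      p m = e₁ * p (m - 1) - e₂ * p (m - 2) + e₃ * p (m - 3) - e₄ * p (m - 4)) :
    p 1 = 0 ∧
    (∀ m : ℕ, 2 ≤ m → Even m → p m = 4 * u ^ m) ∧
    (∀ m : ℕ, 3 ≤ m → Odd m →
      p m = -4 * (m : R) * ((m : R) - 1) * (u₁ * u₂ * u ^ (m - 2))) := by
  subst he₁ he₂ he₃ he₄
  have p2 : p 2 = 4 * u ^ 2 := by rw [hp2]; ring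
  have p3 : p 3 = -24 * (u₁ * u₂ * u) := by rw [hp3, hp1]; ring
  have p4 : p 4 = 4 * u ^ 4 := by rw [hp4, hp1, p2]; ring
  have p5 : p 5 = -80 * (u₁ * u₂ * u ^ 3) := by
    rw [hp 5 le_rfl]
    norm_num only
    rw [p3, p2, hp1]
    ring
  have consecutive : ∀ k : ℕ,
      (p (2 * k + 2) = 4 * u ^ (2 * k + 2) ∧
        p (2 * k + 3) = -4 * (2 * k + 3) * (2 * k + 2) * (u₁ * u₂ * u ^ (2 * k + 1))) ∧
      (p (2 * k + 4) = 4 * u ^ (2 * k + 4) ∧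
        p (2 * k + 5) = -4 * (2 * k + 5) * (2 * k + 4) * (u₁ * u₂ * u ^ (2 * k + 3))) := by
    intro k
    induction k with
    | zero =>
      refine ⟨⟨p2, ?_⟩, p4, ?_⟩
      · simp only [mul_zero, zero_add, p3, Nat.cast_zero]; ring
      · simp only [mul_zero, zero_add, p5, Nat.cast_zero]; ring
    | succ k ih =>
      obtain ⟨⟨h2, h3⟩, h4, h5⟩ := ih
      have h6 := hp (2 * k + 6) (by omega)
      have h7 := hp (2 * k + 7) (by omega)
      simp only [show 2 * k + 6 - 2 = 2 * k + 4 by omega,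
        show 2 * k + 6 - 3 = 2 * k + 3 by omega, show 2 * k + 6 - 4 = 2 * k + 2 by omega,
        show 2 * k + 7 - 2 = 2 * k + 5 by omega, show 2 * k + 7 - 3 = 2 * k + 4 by omega,
        show 2 * k + 7 - 4 = 2 * k + 3 by omega, zero_mul, h2, h3, h4, h5] at h6 h7
      refine ⟨⟨h4, ?_⟩, ?_, ?_⟩
      · rw [show 2 * (k + 1) + 3 = 2 * k + 5 by ring, h5]
        push_cast; ring
      · rw [show 2 * (k + 1) + 4 = 2 * k + 6 by ring, h6]
        linear_combination
          32 * (2 * (k : R) + 3) * (2 * k + 2) * u₂ ^ 2 * u ^ (2 * k + 2) * hu₁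
      · rw [show 2 * (k + 1) + 5 = 2 * k + 7 by ring, h7]
        push_cast; ring
  refine ⟨hp1, fun m hm he => ?_, fun m hm ho => ?_⟩
  · obtain ⟨k, rfl⟩ : ∃ k, m = 2 * k + 2 := by
      obtain ⟨j, rfl⟩ := he
      exact ⟨j - 1, by omega⟩
    exact (consecutive k).1.1
  · obtain ⟨k, rfl⟩ : ∃ k, m = 2 * k + 3 := by
      obtain ⟨j, rfl⟩ := ho
      exact ⟨j - 1, by omega⟩
    rw [(consecutive k).1.2, show 2 * k + 3 - 2 = 2 * k + 1 by omega]
    push_cast; ring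
end

section
/- Let $R$ be a commutative ring and let $(c_i)_{i \ge 1}$ be a sequence in $R$ with $c_i = 0$ for every odd $i$. Define the Newton power-sum sequence $(p_m)_{m \ge 1}$ by $p_m = \sum_{i=1}^{m-1} (-1)^{i-1} c_i\, p_{m-i} + (-1)^{m-1}\, m\, c_m$ for all $m \ge 1$. Set $b_j = (-1)^j c_{2j}$ for $j \ge 1$ and define $(q_n)_{n \ge 1}$ by $q_n = \sum_{j=1}^{n-1} (-1)^{j-1} b_j\, q_{n-j} + (-1)^{n-1}\, n\, b_n$ for all $n \ge 1$. Then for every $n \ge 1$: $p_{2n-1} = 0$ and $p_{2n} = 2 q_n$. -/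
theorem sum_Ico_one_two_mul_of_odd_eq_zero {M : Type*} [AddCommMonoid M] (f : ℕ → M)
    (hf : ∀ i, Odd i → f i = 0) (n : ℕ) (hn : 1 ≤ n) :
    ∑ i ∈ Finset.Ico 1 (2 * n), f i = ∑ j ∈ Finset.Ico 1 n, f (2 * j) := by
  induction n, hn using Nat.le_induction with
  | base => simp [hf 1 odd_one]
  | succ n hn ih =>
    rw [show 2 * (n + 1) = 2 * n + 1 + 1 by ring, Finset.sum_Ico_succ_top (by lia),
      Finset.sum_Ico_succ_top (by lia), Finset.sum_Ico_succ_top hn, ih,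
      hf _ (odd_two_mul_add_one n), add_zero]

theorem neg_one_pow_two_mul_sub_one {R : Type*} [Ring R] {j : ℕ} (hj : 1 ≤ j) :
    (-1 : R) ^ (2 * j - 1) = -1 :=
  Odd.neg_one_pow ⟨j - 1, by lia⟩

theorem neg_one_pow_pred_mul_neg_one_pow {R : Type*} [Ring R] {j : ℕ} (hj : 1 ≤ j) :
    (-1 : R) ^ (j - 1) * (-1) ^ j = -1 := by
  rw [← pow_add, show j - 1 + j = 2 * j - 1 by lia, neg_one_pow_two_mul_sub_one hj]

theorem newton_even_doubling (R : Type*) [CommRing R]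
    (c : ℕ → R) (hodd : ∀ i : ℕ, Odd i → c i = 0)
    (p : ℕ → R)
    (hp : ∀ m : ℕ, 1 ≤ m →
      p m = (∑ i ∈ Finset.Ico 1 m, (-1 : R) ^ (i - 1) * c i * p (m - i))
        + (-1 : R) ^ (m - 1) * (m : R) * c m)
    (b : ℕ → R) (hb : ∀ j : ℕ, 1 ≤ j → b j = (-1 : R) ^ j * c (2 * j))
    (q : ℕ → R)
    (hq : ∀ n : ℕ, 1 ≤ n →
      q n = (∑ j ∈ Finset.Ico 1 n, (-1 : R) ^ (j - 1) * b j * q (n - j))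
        + (-1 : R) ^ (n - 1) * (n : R) * b n) :
    ∀ n : ℕ, 1 ≤ n → p (2 * n - 1) = 0 ∧ p (2 * n) = 2 * q n := by
  have p_odd : ∀ m : ℕ, Odd m → p m = 0 := by
    intro m
    induction m using Nat.strong_induction_on with
    | _ m ih =>
      intro hm
      rw [hp m hm.pos, hodd m hm, mul_zero, add_zero]
      refine Finset.sum_eq_zero fun i hi => ?_
      rw [Finset.mem_Ico] at hi
      rcases Nat.even_or_odd i with he | ho
      · rw [ih (m - i) (by lia) (Nat.Odd.sub_even hi.2.le hm he), mul_zero]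
      · rw [hodd i ho, mul_zero, zero_mul]
  have p_even : ∀ n : ℕ, 1 ≤ n → p (2 * n) = 2 * q n := by
    intro n
    induction n using Nat.strong_induction_on with
    | _ n ih =>
      intro hn
      rw [hp (2 * n) (by lia), hq n hn, mul_add, Finset.mul_sum,
        sum_Ico_one_two_mul_of_odd_eq_zero _ (fun i hi => by rw [hodd i hi]; ring) n hn]
      congr 1
      · refine Finset.sum_congr rfl fun j hj => ?_
        rw [Finset.mem_Ico] at hj
        rw [← Nat.mul_sub, ih (n - j) (by lia) (by lia), hb j hj.1,
          neg_one_pow_two_mul_sub_one hj.1]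
        linear_combination (-2 * c (2 * j) * q (n - j)) *
          neg_one_pow_pred_mul_neg_one_pow (R := R) hj.1
      · rw [hb n hn, neg_one_pow_two_mul_sub_one hn]
        push_cast
        linear_combination (-2 * (n : R) * c (2 * n)) *
          neg_one_pow_pred_mul_neg_one_pow (R := R) hn
  exact fun n hn => ⟨p_odd _ ⟨n - 1, by lia⟩, p_even n hn⟩
end

section
/- Let $k$ be a field of characteristic different from $2$ and $3$, let $V$ be a $2$-dimensional $k$-vector space and let $\varphi$ be a nondegenerate alternating bilinear form on $V$. Let $\Phi = \varphi \otimes \varphi \otimes \varphi$ be the bilinear form on $V \otimes V \otimes V$ determined by $\Phi(x \otimes y \otimes z,\; x' \otimes y' \otimes z') = \varphi(x,x')\varphi(y,y')\varphi(z,z')$, and let $S \subseteq V \otimes V \otimes V$ be the linear span of the set $\{ v \otimes v \otimes v : v \in V \}$. Then there exist $2$-dimensional subspaces $W_1, W_2 \subseteq V \otimes V \otimes V$ such that $V \otimes V \otimes V$ is the internal direct sum of $W_1$, $W_2$ and $S$, the subspaces $W_1$, $W_2$, $S$ are pairwise orthogonal with respect to $\Phi$, and there are linear isometries $(V, 2\varphi)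 \cong (W_1, \Phi|_{W_1})$ and $(V, 6\varphi) \cong (W_2, \Phi|_{W_2})$, where $2\varphi$ and $6\varphi$ denote the form $\varphi$ scaled by $2$ and by $6$ respectively. -/
open TensorProduct

/-- In a family of pairwise orthogonal submodules all but one of which are separated by the form,
the submodules are independent. -/
theorem iSupIndep_of_pairwise_orthogonal {k M ι : Type*} [Field k] [AddCommGroup M] [Module k M]
    (Φ : LinearMap.BilinForm k M) (p : ι → Submodule k M) (i₀ : ι)
    (horth : ∀ i j, i ≠ j → ∀ x ∈ p i, ∀ y ∈ p j, Φ x y = 0)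
    (hsep : ∀ i, i ≠ i₀ → ∀ x ∈ p i, (∀ y ∈ p i, Φ x y = 0) → x = 0) : iSupIndep p := by
  classical
  rw [iSupIndep_iff_finsetSum_eq_zero_imp_eq_zero]
  intro s v hv hsum
  have key : ∀ i ∈ s, i ≠ i₀ → v i = 0 := by
    intro i hi hne
    refine hsep i hne _ (hv i hi) fun y hy => ?_
    have h : Φ (∑ j ∈ s, v j) y = 0 := by simp [hsum]
    rw [map_sum, LinearMap.sum_apply, Finset.sum_eq_single_of_mem i hi] at h
    · exact h
    · exact fun j hj hji => horth j i hji _ (hv j hj) y hy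
  intro i hi
  by_cases hne : i = i₀
  · rwa [Finset.sum_eq_single_of_mem i hi fun j hj hji => key j hj (hne ▸ hji)] at hsum
  · exact key i hi hne

section Similitude

variable {k V M : Type*} [Field k] [AddCommGroup V] [Module k V] [AddCommGroup M] [Module k M]
  {φ : LinearMap.BilinForm k V} {Φ : LinearMap.BilinForm k M} {f : V →ₗ[k] M} {c : k}

theorem injective_of_similitude (hnd : φ.Nondegenerate) (hc : c ≠ 0)
    (hf : ∀ v w, Φ (f v) (f w) = c * φ v w) : Function.Injective f := by
  rw [injective_iff_map_eq_zero]
  intro v hv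
  refine hnd.1 v fun w => ?_
  simpa [hv, hc] using (hf v w).symm

theorem eq_zero_of_mem_range_of_similitude (hnd : φ.Nondegenerate) (hc : c ≠ 0)
    (hf : ∀ v w, Φ (f v) (f w) = c * φ v w) (x : M) (hx : x ∈ LinearMap.range f)
    (h : ∀ y ∈ LinearMap.range f, Φ x y = 0) : x = 0 := by
  obtain ⟨v, rfl⟩ := hx
  have hv : v = 0 := hnd.1 v fun w => by
    simpa [hf, hc] using h (f w) ⟨w, rfl⟩
  simp [hv]

end Similitude

section Symplectic

variable {k V : Type*} [Field k] [AddCommGroup V] [Module k V] {φ : LinearMap.BilinForm k V}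

theorem exists_symplectic_pair [Nontrivial V] (hnd : φ.Nondegenerate) :
    ∃ e f : V, φ e f = 1 := by
  obtain ⟨e, he⟩ := exists_ne (0 : V)
  obtain ⟨f, hf⟩ : ∃ f, φ e f ≠ 0 := by
    by_contra! h
    exact he (hnd.1 e h)
  exact ⟨e, (φ e f)⁻¹ • f, by simp [hf]⟩

theorem eq_symplectic_expansion (hV : Module.finrank k V = 2) (halt : φ.IsAlt) {e f : V}
    (hef : φ e f = 1) (x : V) : x = φ x f • e + φ e x • f := by
  have hfe : φ f e = -1 := by rw [← hef, halt.neg_eq]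
  have hli : LinearIndependent k ![e, f] := by
    rw [LinearIndependent.pair_iff]
    intro s t hst
    have h₁ : φ (s • e + t • f) f = 0 := by simp [hst]
    have h₂ : φ e (s • e + t • f) = 0 := by simp [hst]
    simp only [map_add, map_smul, LinearMap.add_apply, LinearMap.smul_apply, hef,
      halt.self_eq_zero, smul_eq_mul] at h₁ h₂
    exact ⟨by simpa using h₁, by simpa using h₂⟩
  have hx : x ∈ Submodule.span k (Set.range ![e, f]) := by
    rw [hli.span_eq_top_of_card_eq_finrank (by simp [hV])]
    trivial
  rw [Matrix.range_cons_cons_empty, Submodule.mem_span_pair] at hx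
  obtain ⟨a, b, rfl⟩ := hx
  simp [hef, halt.self_eq_zero]

end Symplectic

section TripleTensor

variable {k V : Type*} [Field k] [AddCommGroup V] [Module k V]

/-- The map `v ↦ (e ⊗ f - f ⊗ e) ⊗ v`. -/
def leftInsertion (e f : V) : V →ₗ[k] (V ⊗[k] V) ⊗[k] V :=
  TensorProduct.mk k (V ⊗[k] V) V (e ⊗ₜ f - f ⊗ₜ e)

/-- The map `v ↦ v ⊗ (e ⊗ f - f ⊗ e)`. -/
def rightInsertion (e f : V) : V →ₗ[k] (V ⊗[k] V) ⊗[k] V :=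
  (TensorProduct.mk k (V ⊗[k] V) V).flip f ∘ₗ (TensorProduct.mk k V V).flip e -
    (TensorProduct.mk k (V ⊗[k] V) V).flip e ∘ₗ (TensorProduct.mk k V V).flip f

theorem leftInsertion_apply (e f v : V) :
    leftInsertion (k := k) e f v = (e ⊗ₜ f) ⊗ₜ v - (f ⊗ₜ e) ⊗ₜ v := by
  simp [leftInsertion]

theorem rightInsertion_apply (e f v : V) :
    rightInsertion (k := k) e f v = (v ⊗ₜ e) ⊗ₜ f - (v ⊗ₜ f) ⊗ₜ e := by
  simp [rightInsertion]

/-- Polarization: symmetrized pure tensors are combinations of pure cubes. -/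
theorem symmetrization_mem_span_cubes (x y z : V) :
    (x ⊗ₜ[k] y) ⊗ₜ[k] z + (x ⊗ₜ z) ⊗ₜ y + (y ⊗ₜ x) ⊗ₜ z + (y ⊗ₜ z) ⊗ₜ x + (z ⊗ₜ x) ⊗ₜ y
      + (z ⊗ₜ y) ⊗ₜ x ∈ Submodule.span k {w | ∃ v : V, w = (v ⊗ₜ[k] v) ⊗ₜ[k] v} := by
  set S := Submodule.span k {w | ∃ v : V, w = (v ⊗ₜ[k] v) ⊗ₜ[k] v}
  have hc : ∀ v : V, (v ⊗ₜ[k] v) ⊗ₜ[k] v ∈ S := fun v => Submodule.subset_span ⟨v, rfl⟩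
  have h := S.add_mem (S.add_mem (S.add_mem (S.sub_mem (S.sub_mem (S.sub_mem (hc (x + y + z))
    (hc (x + y))) (hc (x + z))) (hc (y + z))) (hc x)) (hc y)) (hc z)
  convert h using 1
  simp only [add_tmul, tmul_add]
  abel

/-- In dimension two, the two insertions of the symplectic tensor and the pure cubes generate the
triple tensor product. -/
theorem eq_top_of_insertions_mem {φ : LinearMap.BilinForm k V} (h6 : (6 : k) ≠ 0)
    (hV : Module.finrank k V = 2) (halt : φ.IsAlt) {e f : V} (hef : φ e f = 1)
    {T : Submodule k ((V ⊗[k] V) ⊗[k] V)} (hl : ∀ v, leftInsertion e f v ∈ T)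
    (hr : ∀ v, rightInsertion e f v ∈ T) (hc : ∀ v : V, (v ⊗ₜ[k] v) ⊗ₜ[k] v ∈ T) : T = ⊤ := by
  have expand := eq_symplectic_expansion hV halt hef
  have swap₁₂ : ∀ x y z : V, (x ⊗ₜ[k] y) ⊗ₜ[k] z - (y ⊗ₜ x) ⊗ₜ z ∈ T := by
    intro x y z
    convert T.smul_mem (φ x f * φ e y - φ e x * φ y f) (hl z) using 1
    rw [leftInsertion_apply]
    conv_lhs => rw [expand x, expand y]
    simp only [add_tmul, tmul_add, ← smul_tmul', tmul_smul]
    module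
  have swap₂₃ : ∀ x y z : V, (x ⊗ₜ[k] y) ⊗ₜ[k] z - (x ⊗ₜ z) ⊗ₜ y ∈ T := by
    intro x y z
    convert T.smul_mem (φ y f * φ e z - φ e y * φ z f) (hr x) using 1
    rw [rightInsertion_apply]
    conv_lhs => rw [expand y, expand z]
    simp only [add_tmul, tmul_add, ← smul_tmul', tmul_smul]
    module
  have hsymm := fun x y z : V =>
    (Submodule.span_le (p := T)).2 (by rintro _ ⟨v, rfl⟩; exact hc v)
      (symmetrization_mem_span_cubes x y z)
  have hpure : ∀ x y z : V, (x ⊗ₜ[k] y) ⊗ₜ[k] z ∈ T := by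
    intro x y z
    rw [← T.smul_mem_iff h6]
    have h := T.add_mem (T.add_mem (T.add_mem (T.add_mem (T.add_mem (hsymm x y z)
      (T.smul_mem (3 : k) (swap₂₃ x y z))) (T.smul_mem (2 : k) (swap₁₂ x y z)))
      (swap₂₃ y x z)) (T.smul_mem (2 : k) (swap₁₂ x z y))) (swap₂₃ z x y)
    convert h using 1
    module
  rw [eq_top_iff]
  intro t _
  induction t using TensorProduct.induction_on with
  | zero => exact T.zero_mem
  | add a b ha hb => exact T.add_mem (ha trivial) (hb trivial)
  | tmul u z =>
    induction u using TensorProduct.induction_on with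
    | zero => simp
    | add a b ha hb => rw [add_tmul]; exact T.add_mem (ha trivial) (hb trivial)
    | tmul x y => exact hpure x y z

end TripleTensor

theorem symplectic_threefold_tensor_decomposition
    (k : Type*) [Field k] (h2 : ringChar k ≠ 2) (h3 : ringChar k ≠ 3)
    (V : Type*) [AddCommGroup V] [Module k V] [FiniteDimensional k V]
    (hV : Module.finrank k V = 2)
    (φ : LinearMap.BilinForm k V) (hnd : φ.Nondegenerate) (halt : φ.IsAlt)
    (Φ : LinearMap.BilinForm k ((V ⊗[k] V) ⊗[k] V))
    (hΦ : ∀ x y z x' y' z' : V,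
      Φ ((x ⊗ₜ[k] y) ⊗ₜ[k] z) ((x' ⊗ₜ[k] y') ⊗ₜ[k] z')
        = φ x x' * φ y y' * φ z z')
    (S : Submodule k ((V ⊗[k] V) ⊗[k] V))
    (hS : S = Submodule.span k {w | ∃ v : V, w = (v ⊗ₜ[k] v) ⊗ₜ[k] v}) :
    ∃ W₁ W₂ : Submodule k ((V ⊗[k] V) ⊗[k] V),
      Module.finrank k W₁ = 2 ∧ Module.finrank k W₂ = 2 ∧
      DirectSum.IsInternal (![W₁, W₂, S] : Fin 3 → Submodule k ((V ⊗[k] V) ⊗[k] V)) ∧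
      (∀ i j : Fin 3, i ≠ j →
        ∀ x ∈ (![W₁, W₂, S] : Fin 3 → Submodule k ((V ⊗[k] V) ⊗[k] V)) i,
        ∀ y ∈ (![W₁, W₂, S] : Fin 3 → Submodule k ((V ⊗[k] V) ⊗[k] V)) j,
          Φ x y = 0) ∧
      (∃ e₁ : V ≃ₗ[k] W₁, ∀ v w : V, Φ ↑(e₁ v) ↑(e₁ w) = 2 * φ v w) ∧
      (∃ e₂ : V ≃ₗ[k] W₂, ∀ v w : V, Φ ↑(e₂ v) ↑(e₂ w) = 6 * φ v w) := by
  have hk2 : (2 : k) ≠ 0 := Ring.two_ne_zero h2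
  have hk3 : (3 : k) ≠ 0 := by
    intro h
    rcases (Nat.dvd_prime Nat.prime_three).1 ((ringChar.spec k 3).1 (by exact_mod_cast h)) with h | h
    · exact CharP.ringChar_ne_one h
    · exact h3 h
  have hk6 : (6 : k) ≠ 0 := by
    rw [show (6 : k) = 2 * 3 by norm_num]
    exact mul_ne_zero hk2 hk3
  have : Nontrivial V := Module.nontrivial_of_finrank_pos (R := k) (by omega)
  obtain ⟨e, f, hef⟩ := exists_symplectic_pair hnd
  have hfe : φ f e = -1 := by rw [← hef, halt.neg_eq]
  have hφ : ∀ x y, φ x y = φ x f * φ e y - φ x e * φ f y := by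
    intro x y
    conv_lhs => rw [eq_symplectic_expansion hV halt hef x]
    rw [← halt.neg_eq x e]
    simp [sub_eq_add_neg]
  let A : V →ₗ[k] (V ⊗[k] V) ⊗[k] V := leftInsertion e f
  let B : V →ₗ[k] (V ⊗[k] V) ⊗[k] V := rightInsertion e f
  let C := A + (2 : k) • B
  have hAA : ∀ v w, Φ (A v) (A w) = 2 * φ v w := by
    intro v w
    simp only [A, leftInsertion_apply, map_sub, LinearMap.sub_apply, hΦ, hef, hfe,
      halt.self_eq_zero]
    ring
  have hBB : ∀ v w, Φ (B v) (B w) = 2 * φ v w := by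
    intro v w
    simp only [B, rightInsertion_apply, map_sub, LinearMap.sub_apply, hΦ, hef, hfe,
      halt.self_eq_zero]
    ring
  have hAB : ∀ v w, Φ (A v) (B w) = -φ v w := by
    intro v w
    simp only [A, B, leftInsertion_apply, rightInsertion_apply, map_sub, LinearMap.sub_apply, hΦ,
      hef, hfe, halt.self_eq_zero]
    rw [hφ v w]
    ring
  have hBA : ∀ v w, Φ (B v) (A w) = -φ v w := by
    intro v w
    simp only [A, B, leftInsertion_apply, rightInsertion_apply, map_sub, LinearMap.sub_apply, hΦ,
      hef, hfe, halt.self_eq_zero]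
    rw [hφ v w]
    ring
  have hAC : ∀ v w, Φ (A v) (C w) = 0 := by
    intro v w
    simp [C, hAA, hAB]
  have hCA : ∀ v w, Φ (C v) (A w) = 0 := by
    intro v w
    simp [C, hAA, hBA]
  have hCC : ∀ v w, Φ (C v) (C w) = 6 * φ v w := by
    intro v w
    simp only [C, LinearMap.add_apply, LinearMap.smul_apply, map_add, map_smul, hAA, hAB, hBA, hBB,
      smul_eq_mul]
    ring
  have hS_le : ∀ {P : Submodule k ((V ⊗[k] V) ⊗[k] V)}, (∀ v : V, (v ⊗ₜ[k] v) ⊗ₜ[k] v ∈ P) →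
      S ≤ P := by
    intro P hP
    rw [hS, Submodule.span_le]
    rintro _ ⟨v, rfl⟩
    exact hP v
  have hAS : ∀ v, ∀ s ∈ S, Φ (A v) s = 0 := fun v =>
    hS_le (P := LinearMap.ker (Φ (A v))) fun w => by
      simp only [A, leftInsertion_apply, LinearMap.mem_ker, map_sub, LinearMap.sub_apply, hΦ]
      ring
  have hBS : ∀ v, ∀ s ∈ S, Φ (B v) s = 0 := fun v =>
    hS_le (P := LinearMap.ker (Φ (B v))) fun w => by
      simp only [B, rightInsertion_apply, LinearMap.mem_ker, map_sub, LinearMap.sub_apply, hΦ]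
      ring
  have hSA : ∀ v, ∀ s ∈ S, Φ s (A v) = 0 := fun v =>
    hS_le (P := LinearMap.ker (LinearMap.flip Φ (A v))) fun w => by
      simp only [A, leftInsertion_apply, LinearMap.mem_ker, LinearMap.flip_apply,
        map_sub, LinearMap.sub_apply, hΦ]
      ring
  have hSB : ∀ v, ∀ s ∈ S, Φ s (B v) = 0 := fun v =>
    hS_le (P := LinearMap.ker (LinearMap.flip Φ (B v))) fun w => by
      simp only [B, rightInsertion_apply, LinearMap.mem_ker, LinearMap.flip_apply,
        map_sub, LinearMap.sub_apply, hΦ]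
      ring
  have hCS : ∀ v, ∀ s ∈ S, Φ (C v) s = 0 := fun v s hs => by simp [C, hAS v s hs, hBS v s hs]
  have hSC : ∀ v, ∀ s ∈ S, Φ s (C v) = 0 := fun v s hs => by simp [C, hSA v s hs, hSB v s hs]
  have hAinj := injective_of_similitude hnd hk2 hAA
  have hCinj := injective_of_similitude hnd hk6 hCC
  have horth : ∀ i j : Fin 3, i ≠ j →
      ∀ x ∈ (![LinearMap.range A, LinearMap.range C, S] : Fin 3 → Submodule k _) i,
      ∀ y ∈ (![LinearMap.range A, LinearMap.range C, S] : Fin 3 → Submodule k _) j,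
        Φ x y = 0 := by
    intro i j hij
    fin_cases i <;> fin_cases j
    · exact absurd rfl hij
    · rintro _ ⟨v, rfl⟩ _ ⟨w, rfl⟩
      exact hAC v w
    · rintro _ ⟨v, rfl⟩ s hs
      exact hAS v s hs
    · rintro _ ⟨v, rfl⟩ _ ⟨w, rfl⟩
      exact hCA v w
    · exact absurd rfl hij
    · rintro _ ⟨v, rfl⟩ s hs
      exact hCS v s hs
    · rintro s hs _ ⟨v, rfl⟩
      exact hSA v s hs
    · rintro s hs _ ⟨v, rfl⟩
      exact hSC v s hs
    · exact absurd rfl hij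
  refine ⟨LinearMap.range A, LinearMap.range C, ?_, ?_, ?_, horth,
    ⟨LinearEquiv.ofInjective A hAinj, hAA⟩, ⟨LinearEquiv.ofInjective C hCinj, hCC⟩⟩
  · rw [LinearMap.finrank_range_of_inj hAinj, hV]
  · rw [LinearMap.finrank_range_of_inj hCinj, hV]
  · refine DirectSum.isInternal_submodule_of_iSupIndep_of_iSup_eq_top
      (iSupIndep_of_pairwise_orthogonal Φ _ 2 horth ?_) ?_
    · intro i hi
      fin_cases i
      · exact eq_zero_of_mem_range_of_similitude hnd hk2 hAA
      · exact eq_zero_of_mem_range_of_similitude hnd hk6 hCC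
      · exact absurd rfl hi
    · set p : Fin 3 → Submodule k ((V ⊗[k] V) ⊗[k] V) := ![LinearMap.range A, LinearMap.range C, S]
      have hA : ∀ v, A v ∈ iSup p := fun v => le_iSup p 0 ⟨v, rfl⟩
      have hC : ∀ v, C v ∈ iSup p := fun v => le_iSup p 1 ⟨v, rfl⟩
      refine eq_top_of_insertions_mem hk6 hV halt hef hA (fun v => ?_) fun v =>
        le_iSup p 2 (show _ ∈ S from hS ▸ Submodule.subset_span ⟨v, rfl⟩)
      rw [← (iSup p).smul_mem_iff hk2]
      simpa [C, B] using (iSup p).sub_mem (hC v) (hA v)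
end
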